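/- Let V be a finite-dimensional real inner product space of dimension n ≥ 1, let a ∈ ℝ, b ∈ V, let B : V × V → ℝ be a symmetric bilinear form with vanishing trace, and let ε ≥ 0. If |a + ⟨b, e⟩ + B(e,e)| ≤ ε for every unit vector e ∈ V, then |a| ≤ ε, ‖b‖ ≤ ε, and |B(e,e)| ≤ 2ε for every unit vector e. -/

import Mathlib

open scoped RealInnerProductSpace

/-- The even and odd parts in `e` of `a + ⟪b, e⟫ + B e e` are bounded by any bound on the whole
over the unit sphere. -/
theorem abs_even_le_and_abs_odd_le
    {V : Type*} [NormedAddCommGroup V] [InnerProductSpace ℝ V]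
    {a : ℝ} {b : V} {B : LinearMap.BilinForm ℝ V} {ε : ℝ}
    (h : ∀ e : V, ‖e‖ = 1 → |a + ⟪b, e⟫ + B e e| ≤ ε) {e : V} (he : ‖e‖ = 1) :
    |a + B e e| ≤ ε ∧ |⟪b, e⟫| ≤ ε := by
  have hpos := abs_le.mp (h e he)
  have hneg := abs_le.mp (h (-e) (by rwa [norm_neg]))
  simp only [inner_neg_right, map_neg, LinearMap.neg_apply, neg_neg] at hneg
  constructor <;> rw [abs_le] <;> constructor <;> linarith [hpos.1, hpos.2, hneg.1, hneg.2]

/-- **Independence of harmonic moments (quantitative/'almost isotropy' case).**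
If `|a + ⟨b, e⟩ + B(e,e)| ≤ ε` for every unit vector `e`, where `B` is a
symmetric traceless bilinear form on a finite-dimensional real inner product
space of dimension `n ≥ 1`, then `|a| ≤ ε`, `‖b‖ ≤ ε`, and `|B(e,e)| ≤ 2ε`
for every unit vector `e`. -/
theorem harmonic_moments_almost_independent
    {V : Type*} [NormedAddCommGroup V] [InnerProductSpace ℝ V]
    [FiniteDimensional ℝ V] (hn : 1 ≤ Module.finrank ℝ V)
    (a : ℝ) (b : V) (B : LinearMap.BilinForm ℝ V) (ε : ℝ) (hε : 0 ≤ ε)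
    (hBsymm : ∀ x y, B x y = B y x)
    (hBtrace : ∑ i, B (stdOrthonormalBasis ℝ V i) (stdOrthonormalBasis ℝ V i) = 0)
    (h : ∀ e : V, ‖e‖ = 1 → |a + ⟪b, e⟫ + B e e| ≤ ε) :
    |a| ≤ ε ∧ ‖b‖ ≤ ε ∧ ∀ e : V, ‖e‖ = 1 → |B e e| ≤ 2 * ε := by
  have ha : |a| ≤ ε := by
    have hsum : ∑ i, (a + B (stdOrthonormalBasis ℝ V i) (stdOrthonormalBasis ℝ V i)) =
        Module.finrank ℝ V * a := by
      simp [Finset.sum_add_distrib, hBtrace]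
    have hle : |(Module.finrank ℝ V : ℝ) * a| ≤ Module.finrank ℝ V * ε := by
      rw [← hsum]
      refine (Finset.abs_sum_le_sum_abs _ _).trans ?_
      refine (Finset.sum_le_sum fun i _ =>
        (abs_even_le_and_abs_odd_le h ((stdOrthonormalBasis ℝ V).norm_eq_one i)).1).trans ?_
      simp
    rw [abs_mul, Nat.abs_cast] at hle
    exact le_of_mul_le_mul_left hle (by exact_mod_cast hn)
  refine ⟨ha, ?_, fun e he => ?_⟩
  · rcases eq_or_ne b 0 with rfl | hb
    · simpa using hε
    · have hodd := (abs_even_le_and_abs_odd_le h (norm_smul_inv_norm (𝕜 := ℝ) hb)).2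
      have hb' : ‖b‖ ≠ 0 := norm_ne_zero_iff.mpr hb
      have hinner : ⟪b, ((‖b‖ : ℝ)⁻¹) • b⟫ = ‖b‖ := by
        rw [real_inner_smul_right, real_inner_self_eq_norm_sq]
        field_simp
      exact (hinner.symm.le.trans (le_abs_self _)).trans hodd
  · have heven := abs_le.mp (abs_even_le_and_abs_odd_le h he).1
    have ha' := abs_le.mp ha
    rw [abs_le]
    constructor <;> linarith [heven.1, heven.2, ha'.1, ha'.2]
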